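/- Given any data q₁, q₂, q₃, q₄, q₅ ∈ ℝ assigned to the five cross-stencil cells (cell 1 centered at (0,0), cell 2 at (-1,0), cell 3 at (0,1), cell 4 at (1,0), cell 5 at (0,-1)), the polynomial p₃(x,y) = a₀ + a₁x + a₂x² + a₃y + a₄y² with coefficients a₀ = (7/6)q₁ - (1/24)(q₂ + q₃ + q₄ + q₅), a₁ = -(1/2)q₂ + (1/2)q₄, a₂ = -q₁ + (1/2)q₂ + (1/2)q₄, a₃ = (1/2)q₃ - (1/2)q₅, a₄ = -q₁ + (1/2)q₃ + (1/2)q₅ has cell average over the m-th stencil cell equal to q_m for each m = 1, …, 5. -/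

import Mathlib

open MeasureTheory intervalIntegral

/-- The centers of the five cells of the cross stencil (in scaled unit-cell coordinates):
cell 1 at (0,0), cell 2 at (-1,0), cell 3 at (0,1), cell 4 at (1,0), cell 5 at (0,-1). -/
def crossCenter : Fin 5 → ℝ × ℝ := ![(0, 0), (-1, 0), (0, 1), (1, 0), (0, -1)]

/-- The average of a quadratic over the unit interval centered at `a`. -/
theorem integral_quadratic_unit_interval (a c₀ c₁ c₂ : ℝ) :
    ∫ x in (a - 1/2)..(a + 1/2), (c₀ + c₁ * x + c₂ * x ^ 2)
      = c₀ + c₁ * a + c₂ * (a ^ 2 + 1/12) := by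
  have hderiv : ∀ x ∈ Set.uIcc (a - 1/2) (a + 1/2),
      HasDerivAt (fun x : ℝ => c₀ * x + c₁ / 2 * x ^ 2 + c₂ / 3 * x ^ 3)
        (c₀ + c₁ * x + c₂ * x ^ 2) x := by
    intro x _
    refine HasDerivAt.congr_deriv ((((hasDerivAt_id x).const_mul c₀).add
      ((hasDerivAt_pow 2 x).const_mul (c₁ / 2))).add
      ((hasDerivAt_pow 3 x).const_mul (c₂ / 3))) ?_
    norm_num
    ring
  rw [integral_eq_sub_of_hasDerivAt hderiv
    (Continuous.intervalIntegrable (by fun_prop) _ _)]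
  ring

/-- The cell average of `b₀ + b₁ x + b₂ x² + b₃ y + b₄ y²` over the unit square centered
at `(a, b)`. -/
theorem integral_separable_quadratic_unit_square (a b b₀ b₁ b₂ b₃ b₄ : ℝ) :
    ∫ y in (b - 1/2)..(b + 1/2), ∫ x in (a - 1/2)..(a + 1/2),
        (b₀ + b₁ * x + b₂ * x ^ 2 + b₃ * y + b₄ * y ^ 2)
      = b₀ + b₁ * a + b₂ * (a ^ 2 + 1/12) + b₃ * b + b₄ * (b ^ 2 + 1/12) := by
  have inner_eq : ∀ y : ℝ, ∫ x in (a - 1/2)..(a + 1/2),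
      (b₀ + b₁ * x + b₂ * x ^ 2 + b₃ * y + b₄ * y ^ 2)
        = (b₀ + b₁ * a + b₂ * (a ^ 2 + 1/12)) + b₃ * y + b₄ * y ^ 2 := by
    intro y
    have h := integral_quadratic_unit_interval a (b₀ + b₃ * y + b₄ * y ^ 2) b₁ b₂
    calc _ = ∫ x in (a - 1/2)..(a + 1/2),
          ((b₀ + b₃ * y + b₄ * y ^ 2) + b₁ * x + b₂ * x ^ 2) := by
          congr 1
          ext x
          ring
      _ = _ := by
          rw [h]
          ring
  simp only [inner_eq]
  exact integral_quadratic_unit_interval b _ b₃ b₄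

theorem p3_matches_cell_averages (q : Fin 5 → ℝ) :
    ∀ m : Fin 5,
      (∫ y in ((crossCenter m).2 - 1/2)..((crossCenter m).2 + 1/2),
        ∫ x in ((crossCenter m).1 - 1/2)..((crossCenter m).1 + 1/2),
          (((7/6) * q 0 - (1/24) * (q 1 + q 2 + q 3 + q 4))
            + (-(1/2) * q 1 + (1/2) * q 3) * x
            + (-q 0 + (1/2) * q 1 + (1/2) * q 3) * x ^ 2
            + ((1/2) * q 2 - (1/2) * q 4) * y
            + (-q 0 + (1/2) * q 2 + (1/2) * q 4) * y ^ 2)) = q m := by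
  intro m
  rw [integral_separable_quadratic_unit_square]
  fin_cases m <;> simp [crossCenter] <;> ring
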